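/- (Concentration of the Riemannian gradient.) There exist positive absolute constants c₁ and C₁ such that the following holds. Let x₁,…,x_L ∈ ℝ^N be i.i.d. Bernoulli–Gaussian vectors with parameter θ ∈ (1/N, 1/2), set y_i = x_i, and let f(d) = −(1/L) Σ_{i=1}^L |dᵀ y_i|³ for d ∈ S^{N−1}, so that ∇f(d) = −(3/L) Σ_{i=1}^L (dᵀy_i)|dᵀy_i| y_i. For any δ ∈ (0, c₁ / (N log(L) log(NL) θ^{1/3})^{3/2}) and any L ≥ C₁ δ^{−2} N θ log(Nθ/δ), with probability at least 1 − L^{−1}, sup_{d ∈ S^{N−1}} ‖ (I − d dᵀ)∇f(d) − (I − d dᵀ)𝔼[∇f(d)] ‖ ≤ δ. -/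

import Mathlib

open MeasureTheory ProbabilityTheory Real

/-- The Bernoulli–Gaussian distribution BG(θ) on ℝ. -/
noncomputable def bgMeasure (θ : ℝ) : Measure ℝ :=
  (1 - θ).toNNReal • Measure.dirac 0 + θ.toNNReal • gaussianReal 0 1

instance (θ : ℝ) : IsFiniteMeasure (bgMeasure θ) := by
  unfold bgMeasure; infer_instance

/-- The law of a Bernoulli–Gaussian random vector x ∈ ℝ^N with i.i.d. BG(θ) coordinates. -/
noncomputable def bgPi (θ : ℝ) (N : ℕ) : Measure (Fin N → ℝ) :=
  Measure.pi fun _ => bgMeasure θ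

/-- The joint law of L i.i.d. samples y_i = x_i, x_i ~ BG(θ)^N (dictionary D* = I). -/
noncomputable def bgSamples (θ : ℝ) (N L : ℕ) : Measure (Fin L → Fin N → ℝ) :=
  Measure.pi fun _ => bgPi θ N

/-- Gradient of the empirical objective f(d) = −(1/L)Σᵢ|dᵀyᵢ|³:
∇f(d)_j = −(3/L) Σᵢ (dᵀyᵢ)|dᵀyᵢ| (yᵢ)_j. -/
noncomputable def empGradF (N L : ℕ) (ω : Fin L → Fin N → ℝ) (d : Fin N → ℝ)
    (j : Fin N) : ℝ :=
  -((3 : ℝ) / L) * ∑ i, (∑ k, d k * ω i k) * |∑ k, d k * ω i k| * ω i j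

/-- Gradient of the population objective: 𝔼[∇f(d)]_j = −3𝔼[(dᵀx)|dᵀx| x_j]. -/
noncomputable def popGradF (θ : ℝ) (N : ℕ) (d : Fin N → ℝ) (j : Fin N) : ℝ :=
  ∫ x, -3 * ((∑ k, d k * x k) * |∑ k, d k * x k| * x j) ∂ bgPi θ N

/-- Riemannian gradient (I − ddᵀ)v at d, coordinatewise. -/
noncomputable def tangProj (N : ℕ) (d v : Fin N → ℝ) (j : Fin N) : ℝ :=
  v j - d j * ∑ k, d k * v k

lemma aux_prob {θ : ℝ} (h0 : 0 ≤ θ) (h1 : θ ≤ 1) : IsProbabilityMeasure (bgMeasure θ) := by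
  constructor
  unfold bgMeasure
  simp only [Measure.coe_add, Pi.add_apply, Measure.smul_apply, measure_univ]
  simp only [ENNReal.smul_def, smul_eq_mul, mul_one]
  rw [← ENNReal.coe_add, ← Real.toNNReal_add (by linarith) h0]
  simp

lemma aux_int_bg {θ : ℝ} (h0 : 0 ≤ θ) (h1 : θ ≤ 1) {f : ℝ → ℝ} (hf : StronglyMeasurable f)
    (hi : Integrable f (gaussianReal 0 1)) :
    Integrable f (bgMeasure θ) ∧
      ∫ x, f x ∂(bgMeasure θ) = (1 - θ) * f 0 + θ * ∫ x, f x ∂(gaussianReal 0 1) := by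
  have hd : Integrable f (Measure.dirac (0 : ℝ)) := by
    refine ⟨hf.aestronglyMeasurable, ?_⟩
    simp [HasFiniteIntegral]
  have e1 : Integrable f ((1 - θ).toNNReal • Measure.dirac (0 : ℝ)) := hd.smul_measure_nnreal
  have e2 : Integrable f (θ.toNNReal • gaussianReal 0 1) := hi.smul_measure_nnreal
  refine ⟨e1.add_measure e2, ?_⟩
  unfold bgMeasure
  rw [integral_add_measure e1 e2, integral_smul_nnreal_measure, integral_smul_nnreal_measure,
    integral_dirac]
  simp only [NNReal.smul_def, smul_eq_mul]
  rw [Real.coe_toNNReal _ h0, Real.coe_toNNReal _ (by linarith)]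

lemma aux_gauss_sq : Integrable (fun x : ℝ => exp (x ^ 2 / 4)) (gaussianReal 0 1) ∧
    ∫ x, exp (x ^ 2 / 4) ∂(gaussianReal 0 1) ≤ 2 := by
  have key : ∀ x : ℝ, gaussianPDFReal 0 1 x * exp (x ^ 2 / 4)
      = (√(2 * π))⁻¹ * exp (-(1/4) * x ^ 2) := by
    intro x
    simp only [gaussianPDFReal, NNReal.coe_one, mul_one, sub_zero]
    rw [mul_assoc, ← Real.exp_add]
    congr 2; ring
  constructor
  · rw [gaussianReal_of_var_ne_zero 0 one_ne_zero,
      integrable_withDensity_iff_integrable_smul' (measurable_gaussianPDF 0 1)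
      (by filter_upwards with x using gaussianPDF_lt_top)]
    simp only [toReal_gaussianPDF, smul_eq_mul, key]
    exact (integrable_exp_neg_mul_sq (by norm_num)).const_mul _
  · rw [integral_gaussianReal_eq_integral_smul one_ne_zero]
    simp only [smul_eq_mul, key]
    rw [integral_const_mul, integral_gaussian]
    rw [← div_eq_inv_mul, ← Real.sqrt_div' _ (by positivity)]
    rw [Real.sqrt_le_left (by norm_num)]
    have : π ≠ 0 := Real.pi_ne_zero
    field_simp
    norm_num

lemma aux_bg_exp {θ : ℝ} (h0 : 0 ≤ θ) (h1 : θ ≤ 1) (s : ℝ) :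
    Integrable (fun x : ℝ => exp (s * x)) (bgMeasure θ) ∧
      ∫ x, exp (s * x) ∂(bgMeasure θ) = 1 + θ * (exp (s ^ 2 / 2) - 1) := by
  have h := aux_int_bg h0 h1 (f := fun x => exp (s * x))
    (by fun_prop : Measurable _).stronglyMeasurable (integrable_exp_mul_gaussianReal s)
  refine ⟨h.1, ?_⟩
  rw [h.2]
  have := congrFun (mgf_fun_id_gaussianReal (μ := 0) (v := 1)) s
  simp only [mgf] at this
  rw [this]
  simp
  ring

lemma aux_bg_sq {θ : ℝ} (h0 : 0 ≤ θ) (h1 : θ ≤ 1) :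
    Integrable (fun x : ℝ => exp (x ^ 2 / 4)) (bgMeasure θ) ∧
      ∫ x, exp (x ^ 2 / 4) ∂(bgMeasure θ) ≤ exp θ := by
  have h := aux_int_bg h0 h1 (f := fun x => exp (x ^ 2 / 4))
    (by fun_prop : Measurable _).stronglyMeasurable aux_gauss_sq.1
  refine ⟨h.1, ?_⟩
  rw [h.2]
  have := aux_gauss_sq.2
  have h3 := Real.add_one_le_exp θ
  norm_num
  nlinarith

lemma aux_cosh (a : ℝ) : a ^ 6 ≤ 720 * (cosh a - 1) := by
  have h := Real.hasSum_cosh a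
  have := sum_le_hasSum {0, 3} (fun i _ => by
    have : 0 ≤ a ^ (2 * i) := by rw [pow_mul]; positivity
    positivity) h
  rw [Finset.sum_pair (by norm_num)] at this
  norm_num [Nat.factorial] at this
  linarith

/-- sixth moment -/
lemma aux_moment {θ : ℝ} (h0 : 0 ≤ θ) (h1 : θ ≤ 1) {N : ℕ} (d : Fin N → ℝ)
    (hd : ∑ k, d k ^ 2 ≤ 1) :
    Integrable (fun x : Fin N → ℝ => (∑ k, d k * x k) ^ 6) (bgPi θ N) ∧
      ∫ x, (∑ k, d k * x k) ^ 6 ∂(bgPi θ N) ≤ 1440 * θ := by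
  have := aux_prob h0 h1
  have main : ∀ e : Fin N → ℝ, ∑ k, e k ^ 2 ≤ 1 →
      Integrable (fun x : Fin N → ℝ => exp (∑ k, e k * x k)) (bgPi θ N) ∧
      ∫ x, exp (∑ k, e k * x k) ∂(bgPi θ N) ≤ 1 + 2 * θ := by
    intro e he
    simp only [Real.exp_sum]
    unfold bgPi
    refine ⟨Integrable.fintype_prod (f := fun k x => exp (e k * x)) 
      fun k => (aux_bg_exp h0 h1 (e k)).1, ?_⟩
    rw [integral_fintype_prod_eq_prod (f := fun k x => exp (e k * x))]
    simp only [(aux_bg_exp h0 h1 _).2]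
    calc ∏ k, (1 + θ * (exp (e k ^ 2 / 2) - 1)) ≤ ∏ k, exp (θ * e k ^ 2) := by
          refine Finset.prod_le_prod (fun k _ => ?_) (fun k _ => ?_)
          · have : 1 ≤ exp (e k ^ 2 / 2) := Real.one_le_exp (by positivity)
            nlinarith
          · have hk : e k ^ 2 ≤ 1 :=
              (Finset.single_le_sum (f := fun k => e k ^ 2) (fun i _ => sq_nonneg _)
                (Finset.mem_univ k)).trans he
            have h2 := Real.abs_exp_sub_one_sub_id_le (x := e k ^ 2 / 2)
              (by rw [abs_of_nonneg (by positivity)]; linarith)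
            have h3 := (abs_le.1 h2).2
            have h4 : exp (e k ^ 2 / 2) - 1 ≤ e k ^ 2 := by nlinarith [sq_nonneg (e k)]
            have h5 := Real.add_one_le_exp (θ * e k ^ 2)
            nlinarith
      _ = exp (θ * ∑ k, e k ^ 2) := by rw [← Real.exp_sum, Finset.mul_sum]
      _ ≤ exp θ := by
          apply Real.exp_le_exp.2; nlinarith
      _ ≤ 1 + 2 * θ := by
          have h2 := Real.abs_exp_sub_one_sub_id_le (x := θ)
              (by rw [abs_of_nonneg h0]; linarith)
          have h3 := (abs_le.1 h2).2
          nlinarith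
  obtain ⟨i1, b1⟩ := main d hd
  obtain ⟨i2, b2⟩ := main (fun k => - d k) (by simpa using hd)
  have : IsProbabilityMeasure (bgPi θ N) := by unfold bgPi; infer_instance
  have bd : ∀ x : Fin N → ℝ, (∑ k, d k * x k) ^ 6 ≤
      360 * (exp (∑ k, d k * x k) + exp (∑ k, - d k * x k)) - 720 := by
    intro x
    have := aux_cosh (∑ k, d k * x k)
    rw [Real.cosh_eq, ← Finset.sum_neg_distrib] at this
    simp only [neg_mul]
    linarith
  have ib : Integrable (fun x : Fin N → ℝ => 
      360 * (exp (∑ k, d k * x k) + exp (∑ k, - d k * x k)) - 720) (bgPi θ N) :=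
    ((i1.add i2).const_mul 360).sub (integrable_const _)
  have ii : Integrable (fun x : Fin N → ℝ => (∑ k, d k * x k) ^ 6) (bgPi θ N) := by
    refine ib.mono' (by fun_prop : Measurable _).aestronglyMeasurable ?_
    filter_upwards with x
    rw [Real.norm_of_nonneg (by positivity)]
    exact bd x
  refine ⟨ii, (integral_mono ii ib bd).trans ?_⟩
  have i3 : Integrable (fun x : Fin N → ℝ =>
      exp (∑ k, d k * x k) + exp (∑ k, - d k * x k)) (bgPi θ N) := i1.add i2
  rw [integral_sub (i3.const_mul 360) (integrable_const _), integral_const_mul,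
    integral_add i1 i2]
  simp
  simp at b2
  linarith

lemma aux_normexp {θ : ℝ} (h0 : 0 ≤ θ) (h1 : θ ≤ 1) (N : ℕ) :
    Integrable (fun x : Fin N → ℝ => exp ((∑ k, x k ^ 2) / 4)) (bgPi θ N) ∧
      ∫ x, exp ((∑ k, x k ^ 2) / 4) ∂(bgPi θ N) ≤ exp (N * θ) := by
  have := aux_prob h0 h1
  simp only [Finset.sum_div, Real.exp_sum]
  unfold bgPi
  refine ⟨Integrable.fintype_prod (f := fun k x => exp (x ^ 2 / 4)) 
      fun k => (aux_bg_sq h0 h1).1, ?_⟩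
  rw [integral_fintype_prod_eq_prod (f := fun k x => exp (x ^ 2 / 4))]
  simp only [Finset.prod_const, Finset.card_univ, Fintype.card_fin]
  rw [Real.exp_nat_mul]
  exact pow_le_pow_left₀ (integral_nonneg fun x => (exp_pos _).le) (aux_bg_sq h0 h1).2 _

noncomputable def auxNm {N : ℕ} (x : Fin N → ℝ) : ℝ := √(∑ k, x k ^ 2)

noncomputable def auxPhi {N : ℕ} (d u x : Fin N → ℝ) : ℝ :=
  (∑ k, d k * x k) * |∑ k, d k * x k| * ∑ k, u k * x k

open Classical in
noncomputable def auxPhiT {N : ℕ} (R : ℝ) (d u x : Fin N → ℝ) : ℝ :=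
  if ∑ k, x k ^ 2 ≤ R ^ 2 then auxPhi d u x else 0

lemma auxNm_nonneg {N : ℕ} (x : Fin N → ℝ) : 0 ≤ auxNm x := Real.sqrt_nonneg _

lemma auxNm_sq {N : ℕ} (x : Fin N → ℝ) : auxNm x ^ 2 = ∑ k, x k ^ 2 :=
  Real.sq_sqrt (Finset.sum_nonneg fun _ _ => sq_nonneg _)

lemma auxNm_le_one {N : ℕ} {x : Fin N → ℝ} (h : ∑ k, x k ^ 2 ≤ 1) : auxNm x ≤ 1 :=
  Real.sqrt_le_one.2 h

lemma aux_dot {N : ℕ} (d x : Fin N → ℝ) : |∑ k, d k * x k| ≤ auxNm d * auxNm x := by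
  apply abs_le_of_sq_le_sq
  · rw [mul_pow, auxNm_sq, auxNm_sq]
    exact Finset.sum_mul_sq_le_sq_mul_sq _ _ _
  · exact mul_nonneg (auxNm_nonneg _) (auxNm_nonneg _)

lemma aux_dot1 {N : ℕ} {d : Fin N → ℝ} (x : Fin N → ℝ) (hd : ∑ k, d k ^ 2 ≤ 1) :
    |∑ k, d k * x k| ≤ auxNm x := by
  have := aux_dot d x
  have h1 := auxNm_le_one hd
  nlinarith [auxNm_nonneg x]

lemma auxPhi_meas {N : ℕ} (d u : Fin N → ℝ) : Measurable (auxPhi d u) := by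
  unfold auxPhi; fun_prop

lemma auxPhiT_meas {N : ℕ} (R : ℝ) (d u : Fin N → ℝ) : Measurable (auxPhiT R d u) := by
  unfold auxPhiT
  refine Measurable.ite ?_ (auxPhi_meas d u) measurable_const
  exact measurableSet_le (by fun_prop) measurable_const

lemma auxPhi_le {N : ℕ} {d u : Fin N → ℝ} (x : Fin N → ℝ) (hd : ∑ k, d k ^ 2 ≤ 1)
    (hu : ∑ k, u k ^ 2 ≤ 1) : |auxPhi d u x| ≤ auxNm x ^ 3 := by
  unfold auxPhi
  rw [abs_mul, abs_mul, abs_abs]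
  have h1 := aux_dot1 x hd
  have h2 := aux_dot1 x hu
  calc _ ≤ auxNm x * auxNm x * auxNm x := by
        have := auxNm_nonneg x
        gcongr
    _ = _ := by ring

lemma aux_absabs (a b : ℝ) : abs (a * |a| - b * |b|) ≤ (|a| + |b|) * |a - b| := by
  rcases abs_cases a with ⟨h1, h1'⟩ | ⟨h1, h1'⟩ <;> rcases abs_cases b with ⟨h2, h2'⟩ | ⟨h2, h2'⟩ <;>
  rcases abs_cases (a - b) with ⟨h3, h3'⟩ | ⟨h3, h3'⟩ <;> rw [h1, h2, h3] <;>
  apply abs_le.2 <;> constructor <;> nlinarith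

lemma auxPhi_diff {N : ℕ} {d u d' u' : Fin N → ℝ} (x : Fin N → ℝ) (hd : ∑ k, d k ^ 2 ≤ 1)
    (hu : ∑ k, u k ^ 2 ≤ 1) (hd' : ∑ k, d' k ^ 2 ≤ 1) {ε : ℝ}
    (h1 : auxNm (fun k => d k - d' k) ≤ ε) (h2 : auxNm (fun k => u k - u' k) ≤ ε) :
    |auxPhi d u x - auxPhi d' u' x| ≤ 3 * ε * auxNm x ^ 3 := by
  have a1 := aux_dot1 x hd
  have a2 := aux_dot1 x hd'
  have a3 := aux_dot1 x hu
  have a4 := aux_dot (fun k => d k - d' k) x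
  have a5 := aux_dot (fun k => u k - u' k) x
  simp only [sub_mul, Finset.sum_sub_distrib] at a4 a5
  have n0 := auxNm_nonneg x
  have ε0 : 0 ≤ ε := (auxNm_nonneg _).trans h1
  unfold auxPhi
  generalize (∑ k, d k * x k) = a at *
  generalize (∑ k, d' k * x k) = a' at *
  generalize (∑ k, u k * x k) = b at *
  generalize (∑ k, u' k * x k) = b' at *
  generalize auxNm x = n at *
  replace a4 : |a - a'| ≤ ε * n := a4.trans (by gcongr)
  replace a5 : |b - b'| ≤ ε * n := a5.trans (by gcongr)
  have e : a * |a| * b - a' * |a'| * b' = (a * |a| - a' * |a'|) * b + a' * |a'| * (b - b') := by ring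
  rw [e]
  calc _ ≤ abs (a * |a| - a' * |a'|) * |b| + |a'| * |a'| * |b - b'| := by
        refine (abs_add_le _ _).trans ?_
        rw [abs_mul, abs_mul (a' * |a'|), abs_mul a', abs_abs]
    _ ≤ ((n + n) * (ε * n)) * n + n * n * (ε * n) := by
        gcongr
        refine (aux_absabs a a').trans ?_
        gcongr
    _ = _ := by ring

lemma aux_cube {N : ℕ} (x : Fin N → ℝ) : auxNm x ^ 3 ≤ 128 * exp ((∑ k, x k ^ 2) / 8) := by
  rw [← auxNm_sq]
  have h := Real.quadratic_le_exp_of_nonneg (x := auxNm x ^ 2 / 8) (by positivity)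
  have n0 := auxNm_nonneg x
  generalize auxNm x = n at *
  nlinarith [sq_nonneg (n ^ 2 - n), sq_nonneg (n - 1), sq_nonneg n]

lemma aux_cube' {N : ℕ} (x : Fin N → ℝ) : auxNm x ^ 3 ≤ 128 * exp ((∑ k, x k ^ 2) / 4) := by
  refine (aux_cube x).trans ?_
  have : 0 ≤ ∑ k, x k ^ 2 := Finset.sum_nonneg fun _ _ => sq_nonneg _
  gcongr
  norm_num

lemma auxPhi_int {θ : ℝ} (h0 : 0 ≤ θ) (h1 : θ ≤ 1) {N : ℕ} {d u : Fin N → ℝ}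
    (hd : ∑ k, d k ^ 2 ≤ 1) (hu : ∑ k, u k ^ 2 ≤ 1) : Integrable (auxPhi d u) (bgPi θ N) := by
  refine ((aux_normexp h0 h1 N).1.const_mul 128).mono' (auxPhi_meas d u).aestronglyMeasurable ?_
  filter_upwards with x
  exact (auxPhi_le x hd hu).trans (aux_cube' x)

lemma auxPhiT_le {N : ℕ} {d u : Fin N → ℝ} {R : ℝ} (hR : 0 ≤ R) (x : Fin N → ℝ)
    (hd : ∑ k, d k ^ 2 ≤ 1)
    (hu : ∑ k, u k ^ 2 ≤ 1) : |auxPhiT R d u x| ≤ R ^ 3 := by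
  unfold auxPhiT
  split_ifs with h
  · refine (auxPhi_le x hd hu).trans ?_
    have := auxNm_nonneg x
    have : auxNm x ≤ R := Real.sqrt_le_left hR |>.2 h
    gcongr
  · simp; positivity

lemma auxPhiT_int {θ : ℝ} (h0 : 0 ≤ θ) (h1 : θ ≤ 1) {N : ℕ} {d u : Fin N → ℝ}
    (hd : ∑ k, d k ^ 2 ≤ 1) (hu : ∑ k, u k ^ 2 ≤ 1) (R : ℝ) :
    Integrable (auxPhiT R d u) (bgPi θ N) := by
  refine (auxPhi_int h0 h1 hd hu).mono (auxPhiT_meas R d u).aestronglyMeasurable ?_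
  filter_upwards with x
  unfold auxPhiT
  split_ifs <;> simp

lemma aux_bias {θ : ℝ} (h0 : 0 ≤ θ) (h1 : θ ≤ 1) {N : ℕ} {d u : Fin N → ℝ}
    (hd : ∑ k, d k ^ 2 ≤ 1) (hu : ∑ k, u k ^ 2 ≤ 1) (R : ℝ) :
    |∫ x, auxPhi d u x ∂(bgPi θ N) - ∫ x, auxPhiT R d u x ∂(bgPi θ N)|
      ≤ 128 * exp (N * θ - R ^ 2 / 8) := by
  rw [← integral_sub (auxPhi_int h0 h1 hd hu) (auxPhiT_int h0 h1 hd hu R)]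
  have hE := aux_normexp h0 h1 N
  calc _ ≤ ∫ x, |auxPhi d u x - auxPhiT R d u x| ∂(bgPi θ N) := abs_integral_le_integral_abs
    _ ≤ ∫ x : Fin N → ℝ, (128 * exp (- (R ^ 2 / 8))) * exp ((∑ k, x k ^ 2) / 4) ∂(bgPi θ N) := by
        refine integral_mono ((auxPhi_int h0 h1 hd hu).sub (auxPhiT_int h0 h1 hd hu R)).abs
          (hE.1.const_mul _) fun x => ?_
        simp only
        unfold auxPhiT
        split_ifs with h
        · simp; positivity
        · rw [sub_zero]
          refine (auxPhi_le x hd hu).trans ((aux_cube x).trans ?_)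
          rw [mul_assoc, ← Real.exp_add]
          push Not at h
          gcongr
          linarith
    _ ≤ (128 * exp (- (R ^ 2 / 8))) * exp (N * θ) := by
        rw [integral_const_mul]
        gcongr
        exact hE.2
    _ = _ := by rw [mul_assoc, ← Real.exp_add]; ring_nf

lemma auxPhiT_sq {θ : ℝ} (h0 : 0 ≤ θ) (h1 : θ ≤ 1) {N : ℕ} {d u : Fin N → ℝ}
    (hd : ∑ k, d k ^ 2 ≤ 1) (hu : ∑ k, u k ^ 2 ≤ 1) (R : ℝ) :
    Integrable (fun x => auxPhiT R d u x ^ 2) (bgPi θ N) ∧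
    ∫ x, auxPhiT R d u x ^ 2 ∂(bgPi θ N) ≤ 2880 * θ := by
  obtain ⟨i1, b1⟩ := aux_moment h0 h1 d hd
  obtain ⟨i2, b2⟩ := aux_moment h0 h1 u hu
  have bd : ∀ x, auxPhiT R d u x ^ 2 ≤ (∑ k, d k * x k) ^ 6 + (∑ k, u k * x k) ^ 6 := by
    intro x
    unfold auxPhiT
    split_ifs
    · unfold auxPhi
      generalize (∑ k, d k * x k) = a
      generalize (∑ k, u k * x k) = b
      rw [mul_pow, mul_pow, sq_abs]
      have ha : 0 ≤ a ^ 2 := sq_nonneg a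
      have hb : 0 ≤ b ^ 2 := sq_nonneg b
      have e1 : a ^ 6 = (a ^ 2) ^ 3 := by ring
      have e2 : b ^ 6 = (b ^ 2) ^ 3 := by ring
      rw [e1, e2]
      generalize a ^ 2 = p at *
      generalize b ^ 2 = q at *
      rcases le_total p q with h | h
      · have : p * p * q ≤ q * q * q := by gcongr
        have : 0 ≤ p ^ 3 := by positivity
        nlinarith
      · have : p * p * q ≤ p * p * p := by gcongr
        have : 0 ≤ q ^ 3 := by positivity
        nlinarith
    · rw [zero_pow two_ne_zero]; positivity
  have ii : Integrable (fun x => auxPhiT R d u x ^ 2) (bgPi θ N) := by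
    refine (i1.add i2).mono' ((auxPhiT_meas R d u).pow_const 2).aestronglyMeasurable ?_
    filter_upwards with x
    rw [Real.norm_of_nonneg (by positivity)]
    exact bd x
  refine ⟨ii, (integral_mono ii (i1.add i2) bd).trans ?_⟩
  simp only [Pi.add_apply]
  rw [integral_add i1 i2]
  linarith

lemma aux_chernoff {E : Type*} [MeasurableSpace E] (μ : Measure E) [IsProbabilityMeasure μ]
    (Z : E → ℝ) (hZ : Measurable Z) {M V lam t : ℝ} (hM : ∀ x, |Z x| ≤ M)
    (hi2 : Integrable (fun x => Z x ^ 2) μ)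
    (hV : ∫ x, Z x ^ 2 ∂μ ≤ V) (hl : 0 ≤ lam) (hlM : lam * M ≤ 1) (L : ℕ) :
    (Measure.pi fun _ : Fin L => μ).real {ω | L * (∫ x, Z x ∂μ + t) ≤ ∑ i, Z (ω i)} ≤
      exp (L * (lam ^ 2 * V - lam * t)) := by
  have hi1 : Integrable Z μ := by
    refine (integrable_const M).mono' hZ.aestronglyMeasurable ?_
    filter_upwards with x using hM x
  set m := ∫ x, Z x ∂μ with hm
  have hlz : ∀ x, |lam * Z x| ≤ 1 := fun x => by
    rw [abs_mul, abs_of_nonneg hl]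
    exact (mul_le_mul_of_nonneg_left (hM x) hl).trans hlM
  have bd : ∀ x, exp (lam * Z x) ≤ 1 + lam * Z x + lam ^ 2 * Z x ^ 2 := fun x => by
    have := (abs_le.1 (Real.abs_exp_sub_one_sub_id_le (hlz x))).2
    nlinarith
  have ie : Integrable (fun x => exp (lam * Z x)) μ := by
    refine (integrable_const (exp 1)).mono' (by fun_prop : Measurable _).aestronglyMeasurable ?_
    filter_upwards with x
    rw [Real.norm_of_nonneg (exp_pos _).le]
    exact Real.exp_le_exp.2 (abs_le.1 (hlz x)).2
  have i3 : Integrable (fun x => 1 + lam * Z x) μ := (integrable_const _).add (hi1.const_mul _)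
  have hE : ∫ x, exp (lam * Z x) ∂μ ≤ exp (lam * m + lam ^ 2 * V) := by
    refine (integral_mono ie (i3.add (hi2.const_mul (lam ^ 2))) bd).trans ?_
    simp only [Pi.add_apply]
    rw [integral_add i3 (hi2.const_mul _), integral_add (integrable_const _) (hi1.const_mul _),
      integral_const_mul, integral_const_mul]
    simp only [integral_const, probReal_univ, smul_eq_mul, mul_one, ← hm]
    have := Real.add_one_le_exp (lam * m + lam ^ 2 * V)
    nlinarith [sq_nonneg lam]
  have hprod : ∫ ω, exp (lam * ∑ i, Z (ω i)) ∂(Measure.pi fun _ : Fin L => μ)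
      ≤ exp (L * (lam * m + lam ^ 2 * V)) := by
    simp only [Finset.mul_sum, Real.exp_sum]
    rw [integral_fintype_prod_eq_prod (f := fun _ x => exp (lam * Z x))]
    simp only [Finset.prod_const, Finset.card_univ, Fintype.card_fin]
    rw [Real.exp_nat_mul]
    exact pow_le_pow_left₀ (integral_nonneg fun x => (exp_pos _).le) hE _
  have hint : Integrable (fun ω : Fin L → E => exp (lam * ∑ i, Z (ω i)))
      (Measure.pi fun _ : Fin L => μ) := by
    simp only [Finset.mul_sum, Real.exp_sum]
    exact Integrable.fintype_prod (f := fun _ x => exp (lam * Z x)) fun _ => ie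
  have hmk := mul_meas_ge_le_integral_of_nonneg (ae_of_all _ fun ω => (exp_pos _).le) hint
    (exp (lam * (L * (m + t))))
  have hsub : (Measure.pi fun _ : Fin L => μ).real {ω | L * (m + t) ≤ ∑ i, Z (ω i)} ≤
     (Measure.pi fun _ : Fin L => μ).real
       {ω | exp (lam * (L * (m + t))) ≤ exp (lam * ∑ i, Z (ω i))} := by
    refine measureReal_mono (fun ω h => ?_) (measure_ne_top _ _)
    change L * (m + t) ≤ ∑ i, Z (ω i) at h
    change exp (lam * (L * (m + t))) ≤ exp (lam * ∑ i, Z (ω i))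
    gcongr
  refine hsub.trans ?_
  have h5 := hmk.trans hprod
  have : exp (L * (lam ^ 2 * V - lam * t)) =
      exp (L * (lam * m + lam ^ 2 * V)) / exp (lam * (L * (m + t))) := by
    rw [← Real.exp_sub]; ring_nf
  rw [this, le_div_iff₀' (exp_pos _)]
  exact h5

lemma aux_tail {θ : ℝ} (h0 : 0 ≤ θ) (h1 : θ ≤ 1) (N : ℕ) (R : ℝ) :
    (bgPi θ N).real {x | R ^ 2 < ∑ k, x k ^ 2} ≤ exp (N * θ - R ^ 2 / 4) := by
  have := aux_prob h0 h1
  have : IsProbabilityMeasure (bgPi θ N) := by unfold bgPi; infer_instance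
  have hE := aux_normexp h0 h1 N
  have hmk := mul_meas_ge_le_integral_of_nonneg (ae_of_all _ fun ω => (exp_pos _).le) hE.1
    (exp (R ^ 2 / 4))
  rw [Real.exp_sub, le_div_iff₀' (exp_pos _)]
  refine le_trans ?_ (hmk.trans hE.2)
  refine mul_le_mul_of_nonneg_left ?_ (exp_pos _).le
  refine measureReal_mono (fun x h => ?_) (measure_ne_top _ _)
  change R ^ 2 < ∑ k, x k ^ 2 at h
  change exp (R ^ 2 / 4) ≤ exp ((∑ k, x k ^ 2) / 4)
  gcongr

lemma aux_round1 {K : ℕ} (hK : 0 < K) (a : ℝ) (ha : |a| ≤ 1) :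
    ∃ z : Fin (2 * K + 1), |((z : ℕ) - K : ℝ) / K| ≤ |a| ∧ |a - ((z : ℕ) - K : ℝ) / K| ≤ 1 / K := by
  have hK' : (0 : ℝ) < K := by exact_mod_cast hK
  have hm : ⌊|a| * K⌋₊ ≤ K := by
    apply Nat.floor_le_of_le
    nlinarith
  have f1 := Nat.floor_le (a := |a| * K) (by positivity)
  have f2 := Nat.lt_floor_add_one (|a| * K)
  generalize ⌊|a| * K⌋₊ = m at *
  have g1 : (m : ℝ) / K ≤ |a| := by rw [div_le_iff₀ hK']; exact f1
  have g2 : |a| - m / K ≤ 1 / K := by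
    rw [sub_le_iff_le_add, ← add_div, le_div_iff₀ hK']; linarith
  have g3 : 0 ≤ (m : ℝ) / K := by positivity
  rcases le_total 0 a with h | h
  · refine ⟨⟨K + m, by omega⟩, ?_⟩
    have : (((K + m : ℕ) : ℝ) - K) / K = m / K := by push_cast; ring
    simp only [this]
    rw [abs_of_nonneg h] at *
    rw [abs_of_nonneg g3, abs_of_nonneg (by linarith)]
    exact ⟨g1, g2⟩
  · refine ⟨⟨K - m, by omega⟩, ?_⟩
    have : (((K - m : ℕ) : ℝ) - K) / K = -(m / K) := by rw [Nat.cast_sub hm]; ring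
    simp only [this]
    rw [abs_of_nonpos h] at *
    rw [abs_neg, abs_of_nonneg g3, abs_of_nonpos (by linarith)]
    exact ⟨g1, by linarith⟩

noncomputable def auxGrid {N : ℕ} (K : ℕ) (z : Fin N → Fin (2 * K + 1)) : Fin N → ℝ :=
  fun k => (((z k : ℕ) : ℝ) - K) / K

lemma aux_round {N K : ℕ} (hK : 0 < K) (d : Fin N → ℝ) (hd : ∑ k, d k ^ 2 ≤ 1) :
    ∃ z : Fin N → Fin (2 * K + 1), ∑ k, auxGrid K z k ^ 2 ≤ 1 ∧
      auxNm (fun k => d k - auxGrid K z k) ≤ N / K := by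
  have hk : ∀ k, |d k| ≤ 1 := fun k => by
    have : d k ^ 2 ≤ 1 := (Finset.single_le_sum (f := fun k => d k ^ 2) (fun i _ => sq_nonneg _)
                (Finset.mem_univ k)).trans hd
    exact abs_le_one_iff_mul_self_le_one.2 (by nlinarith)
  choose z hz1 hz2 using fun k => aux_round1 hK (d k) (hk k)
  refine ⟨z, le_trans (Finset.sum_le_sum fun k _ => ?_) hd, ?_⟩
  · exact sq_le_sq.2 (hz1 k)
  · unfold auxNm
    rw [Real.sqrt_le_left (by positivity)]
    calc ∑ k, (d k - auxGrid K z k) ^ 2 ≤ ∑ k : Fin N, (1 / (K : ℝ)) ^ 2 := by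
          refine Finset.sum_le_sum fun k _ => ?_
          rw [sq_le_sq, abs_of_nonneg (by positivity : (0:ℝ) ≤ 1 / K)]
          exact hz2 k
      _ = N * (1 / (K : ℝ)) ^ 2 := by simp
      _ ≤ _ := by
          have : (N : ℝ) ≤ (N : ℝ) ^ 2 := by exact_mod_cast Nat.le_self_pow (by norm_num) N
          rw [div_pow, div_pow, one_pow, mul_one_div]
          gcongr

lemma aux_pair {θ : ℝ} (h0 : 0 ≤ θ) (h1 : θ ≤ 1) {N L K : ℕ} (hL : 0 < L) (hK : 0 < K)
    {R t : ℝ} (hR : 0 ≤ R) (ω : Fin L → Fin N → ℝ)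
    (hω : ∀ i, ∑ k, ω i k ^ 2 ≤ R ^ 2)
    (hnet : ∀ z z' : Fin N → Fin (2 * K + 1), ∑ k, auxGrid K z k ^ 2 ≤ 1 →
      ∑ k, auxGrid K z' k ^ 2 ≤ 1 →
      ∑ i, auxPhiT R (auxGrid K z) (auxGrid K z') (ω i) ≤
        L * (∫ x, auxPhiT R (auxGrid K z) (auxGrid K z') x ∂(bgPi θ N) + t))
    (d u : Fin N → ℝ) (hd : ∑ k, d k ^ 2 ≤ 1) (hu : ∑ k, u k ^ 2 ≤ 1) :
    1 / (L : ℝ) * ∑ i, auxPhi d u (ω i) - ∫ x, auxPhi d u x ∂(bgPi θ N) ≤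
      t + 6 * (N / K) * R ^ 3 + 128 * exp (N * θ - R ^ 2 / 8) := by
  have := aux_prob h0 h1
  have : IsProbabilityMeasure (bgPi θ N) := by unfold bgPi; infer_instance
  obtain ⟨z, hz1, hz2⟩ := aux_round hK d hd
  obtain ⟨z', hz1', hz2'⟩ := aux_round hK u hu
  have hn := hnet z z' hz1 hz1'
  have hb := abs_le.1 (aux_bias h0 h1 hd hu R)
  set g := auxGrid K z
  set g' := auxGrid K z'
  set ε : ℝ := N / K
  have hε : 0 ≤ ε := by positivity
  have hdiff : ∀ x, |auxPhiT R d u x - auxPhiT R g g' x| ≤ 3 * ε * R ^ 3 := by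
    intro x
    unfold auxPhiT
    split_ifs with h
    · refine (auxPhi_diff x hd hu hz1 hz2 hz2').trans ?_
      have := auxNm_nonneg x
      have : auxNm x ≤ R := Real.sqrt_le_left hR |>.2 h
      gcongr
    · simp; positivity
  have hint : |∫ x, auxPhiT R d u x ∂(bgPi θ N) - ∫ x, auxPhiT R g g' x ∂(bgPi θ N)|
      ≤ 3 * ε * R ^ 3 := by
    rw [← integral_sub (auxPhiT_int h0 h1 hd hu R) (auxPhiT_int h0 h1 hz1 hz1' R)]
    have := norm_integral_le_of_norm_le_const (μ := bgPi θ N)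
      (f := fun x => auxPhiT R d u x - auxPhiT R g g' x) (ae_of_all _ hdiff)
    simpa using this
  have hint' := abs_le.1 hint
  have hsum : ∑ i, auxPhi d u (ω i) ≤ ∑ i, auxPhiT R g g' (ω i) + L * (3 * ε * R ^ 3) := by
    have : (L : ℝ) * (3 * ε * R ^ 3) = ∑ i : Fin L, 3 * ε * R ^ 3 := by simp
    rw [this, ← Finset.sum_add_distrib]
    refine Finset.sum_le_sum fun i _ => ?_
    have h2 := (abs_le.1 (hdiff (ω i))).2
    have : auxPhiT R d u (ω i) = auxPhi d u (ω i) := by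
      unfold auxPhiT; rw [if_pos (hω i)]
    linarith
  have hL' : (0 : ℝ) < L := by exact_mod_cast hL
  have : 1 / (L : ℝ) * ∑ i, auxPhi d u (ω i) ≤
      (∫ x, auxPhiT R g g' x ∂(bgPi θ N) + t) + 3 * ε * R ^ 3 := by
    rw [one_div, inv_mul_le_iff₀ hL']
    linarith
  linarith

lemma aux_pop {θ : ℝ} (h0 : 0 ≤ θ) (h1 : θ ≤ 1) {N : ℕ} 
    (d u : Fin N → ℝ) (hd : ∑ k, d k ^ 2 ≤ 1) :
    ∑ j, u j * popGradF θ N d j = -3 * ∫ x, auxPhi d u x ∂(bgPi θ N) := by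
  unfold popGradF
  have hint : ∀ j, Integrable (fun x : Fin N → ℝ => (∑ k, d k * x k) * |∑ k, d k * x k| * x j)
      (bgPi θ N) := by
    intro j
    have := auxPhi_int h0 h1 (u := Pi.single j 1) hd (by simp [Pi.single_apply])
    unfold auxPhi at this
    simpa [Pi.single_apply] using this
  simp only [integral_const_mul]
  have : ∀ x : Fin N → ℝ, auxPhi d u x =
      ∑ j, u j * ((∑ k, d k * x k) * |∑ k, d k * x k| * x j) := by
    intro x
    unfold auxPhi
    rw [Finset.mul_sum]
    refine Finset.sum_congr rfl fun j _ => by ring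
  simp only [this]
  rw [integral_finsetSum _ fun j _ => (hint j).const_mul _, Finset.mul_sum]
  refine Finset.sum_congr rfl fun j _ => ?_
  rw [integral_const_mul]
  ring

lemma aux_emp {N L : ℕ} (ω : Fin L → Fin N → ℝ) (d u : Fin N → ℝ) :
    ∑ j, u j * empGradF N L ω d j = -3 * (1 / (L : ℝ) * ∑ i, auxPhi d u (ω i)) := by
  unfold empGradF auxPhi
  simp only [Finset.mul_sum]
  rw [Finset.sum_comm]
  refine Finset.sum_congr rfl fun i _ => Finset.sum_congr rfl fun j _ => ?_
  ring

lemma aux_proj {N : ℕ} (d a b : Fin N → ℝ) (hd : ∑ k, d k ^ 2 = 1) :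
    ∑ j, (tangProj N d a j - tangProj N d b j) ^ 2 ≤ ∑ j, (a j - b j) ^ 2 := by
  unfold tangProj
  set s := ∑ k, d k * (a k - b k) with hs
  have e : ∀ j, (a j - d j * ∑ k, d k * a k - (b j - d j * ∑ k, d k * b k)) ^ 2 =
      (a j - b j) ^ 2 - 2 * s * (d j * (a j - b j)) + s ^ 2 * d j ^ 2 := by
    intro j
    have : s = ∑ k, d k * a k - ∑ k, d k * b k := by
      rw [hs, ← Finset.sum_sub_distrib]
      exact Finset.sum_congr rfl fun k _ => by ring
    rw [this]
    ring
  simp only [e]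
  rw [Finset.sum_add_distrib, Finset.sum_sub_distrib, ← Finset.mul_sum, ← Finset.mul_sum, hd, ← hs]
  nlinarith [sq_nonneg s]

lemma aux_final_det {θ : ℝ} (h0 : 0 ≤ θ) (h1 : θ ≤ 1) {N L : ℕ} (ω : Fin L → Fin N → ℝ)
    (d : Fin N → ℝ) (hd : ∑ k, d k ^ 2 = 1) {B : ℝ} (hB : 0 ≤ B)
    (H : ∀ u : Fin N → ℝ, ∑ k, u k ^ 2 ≤ 1 →
      1 / (L : ℝ) * ∑ i, auxPhi d u (ω i) - ∫ x, auxPhi d u x ∂(bgPi θ N) ≤ B) :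
    Real.sqrt (∑ j, (tangProj N d (empGradF N L ω d) j -
                tangProj N d (popGradF θ N d) j) ^ 2) ≤ 3 * B := by
  refine (Real.sqrt_le_sqrt (aux_proj d _ _ hd)).trans ?_
  set v : Fin N → ℝ := fun j => empGradF N L ω d j - popGradF θ N d j with hv
  change auxNm v ≤ _
  rcases (auxNm_nonneg v).eq_or_lt with h | h
  · rw [← h]; positivity
  · have hu : ∑ k, (-(v k / auxNm v)) ^ 2 = 1 := by
      simp only [neg_sq, div_pow]
      rw [← Finset.sum_div, ← auxNm_sq, div_self (by positivity)]
    have := H _ hu.le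
    have e1 := aux_pop h0 h1 d (fun k => -(v k / auxNm v)) hd.le
    have e2 := aux_emp ω d (fun k => -(v k / auxNm v))
    have e3 : ∑ j, -(v j / auxNm v) * empGradF N L ω d j -
        ∑ j, -(v j / auxNm v) * popGradF θ N d j = - auxNm v := by
      rw [← Finset.sum_sub_distrib]
      have : ∀ j, -(v j / auxNm v) * empGradF N L ω d j - -(v j / auxNm v) * popGradF θ N d j
          = - (v j ^ 2 / auxNm v) := by
        intro j
        simp only [hv]; ring
      simp only [this]
      rw [Finset.sum_neg_distrib, ← Finset.sum_div, ← auxNm_sq]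
      field_simp
    linarith

lemma aux_prob_main {θ : ℝ} (h0 : 0 ≤ θ) (h1 : θ ≤ 1) {N L K : ℕ} (hL : 0 < L) (hK : 0 < K)
    {R t lam : ℝ} (hR : 0 ≤ R) (ht : 0 ≤ t) (hl : 0 ≤ lam) (hlR : lam * R ^ 3 ≤ 1) {δ : ℝ}
    (hδ : 3 * (t + 6 * (N / K) * R ^ 3 + 128 * exp (N * θ - R ^ 2 / 8)) ≤ δ)
    {η : ℝ} (hη : L * exp (N * θ - R ^ 2 / 4) +
      ((2 * K + 1 : ℕ) : ℝ) ^ (2 * N) * exp (L * (lam ^ 2 * (2880 * θ) - lam * t)) ≤ η) :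
        bgSamples θ N L
            {ω | ∀ d : Fin N → ℝ, ∑ i, d i ^ 2 = 1 →
              Real.sqrt (∑ j, (tangProj N d (empGradF N L ω d) j -
                tangProj N d (popGradF θ N d) j) ^ 2) ≤ δ} ≥
          ENNReal.ofReal (1 - η) := by
  have := aux_prob h0 h1
  have : IsProbabilityMeasure (bgPi θ N) := by unfold bgPi; infer_instance
  have : IsProbabilityMeasure (bgSamples θ N L) := by unfold bgSamples; infer_instance
  set S := {ω : Fin L → Fin N → ℝ | ∀ d : Fin N → ℝ, ∑ i, d i ^ 2 = 1 →
              Real.sqrt (∑ j, (tangProj N d (empGradF N L ω d) j -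
                tangProj N d (popGradF θ N d) j) ^ 2) ≤ δ} with hS
  set B1 : Set (Fin L → Fin N → ℝ) := ⋃ i : Fin L, {ω | R ^ 2 < ∑ k, ω i k ^ 2} with hB1
  let P := (Fin N → Fin (2 * K + 1)) × (Fin N → Fin (2 * K + 1))
  let bad : P → Set (Fin L → Fin N → ℝ) := fun p =>
    {ω | (∑ k, auxGrid K p.1 k ^ 2 ≤ 1 ∧ ∑ k, auxGrid K p.2 k ^ 2 ≤ 1) ∧
      L * (∫ x, auxPhiT R (auxGrid K p.1) (auxGrid K p.2) x ∂(bgPi θ N) + t) ≤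
        ∑ i, auxPhiT R (auxGrid K p.1) (auxGrid K p.2) (ω i)}
  set B2 : Set (Fin L → Fin N → ℝ) := ⋃ p : P, bad p with hB2
  have cover : Set.univ ⊆ S ∪ (B1 ∪ B2) := by
    intro ω _
    by_contra hc
    rw [Set.mem_union, Set.mem_union, not_or, not_or] at hc
    obtain ⟨c1, c2, c3⟩ := hc
    apply c1
    intro d hd
    have hω : ∀ i, ∑ k, ω i k ^ 2 ≤ R ^ 2 := by
      intro i
      by_contra hi
      push Not at hi
      exact c2 (Set.mem_iUnion.2 ⟨i, hi⟩)
    refine (aux_final_det h0 h1 ω d hd (B := _) ?_ fun u hu =>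
      aux_pair h0 h1 hL hK hR ω hω (t := t) ?_ d u hd.le hu).trans hδ
    · positivity
    · intro z z' hz hz'
      by_contra hi
      push Not at hi
      exact c3 (Set.mem_iUnion.2 ⟨(z, z'), ⟨hz, hz'⟩, hi.le⟩)
  have m1 : (bgSamples θ N L).real B1 ≤ L * exp (N * θ - R ^ 2 / 4) := by
    refine (measureReal_iUnion_fintype_le _).trans ?_
    have : ∀ i : Fin L, (bgSamples θ N L).real {ω | R ^ 2 < ∑ k, ω i k ^ 2} ≤
        exp (N * θ - R ^ 2 / 4) := by
      intro i
      refine le_trans (le_of_eq ?_) (aux_tail h0 h1 N R)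
      have hmp := measurePreserving_eval (fun _ : Fin L => bgPi θ N) i
      have hms : MeasurableSet {x : Fin N → ℝ | R ^ 2 < ∑ k, x k ^ 2} :=
        measurableSet_lt measurable_const (by fun_prop)
      have := hmp.measure_preimage hms.nullMeasurableSet
      unfold bgSamples Measure.real
      rw [← this]
      rfl
    refine (Finset.sum_le_sum fun i _ => this i).trans ?_
    simp
  have m2 : (bgSamples θ N L).real B2 ≤
      ((2 * K + 1 : ℕ) : ℝ) ^ (2 * N) * exp (L * (lam ^ 2 * (2880 * θ) - lam * t)) := by
    refine (measureReal_iUnion_fintype_le _).trans ?_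
    have : ∀ p : P, (bgSamples θ N L).real (bad p) ≤
        exp (L * (lam ^ 2 * (2880 * θ) - lam * t)) := by
      intro p
      by_cases hp : ∑ k, auxGrid K p.1 k ^ 2 ≤ 1 ∧ ∑ k, auxGrid K p.2 k ^ 2 ≤ 1
      · have hsq := auxPhiT_sq h0 h1 hp.1 hp.2 R
        refine le_trans (measureReal_mono ?_ (measure_ne_top _ _))
          (aux_chernoff (bgPi θ N) _ (auxPhiT_meas R (auxGrid K p.1) (auxGrid K p.2))
          (fun x => auxPhiT_le hR x hp.1 hp.2) hsq.1 hsq.2 hl hlR L)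
        intro ω h
        exact h.2
      · have : bad p = ∅ := by
          ext ω
          simp only [Set.mem_empty_iff_false, iff_false]
          intro h
          exact hp h.1
        rw [this, measureReal_empty]
        positivity
    refine (Finset.sum_le_sum fun i _ => this i).trans ?_
    simp [P, ← pow_add, two_mul]
  have h2 : 1 ≤ (bgSamples θ N L).real S + ((bgSamples θ N L).real B1
      + (bgSamples θ N L).real B2) := by
    calc (1 : ℝ) = (bgSamples θ N L).real Set.univ := by simp
      _ ≤ (bgSamples θ N L).real (S ∪ (B1 ∪ B2)) := measureReal_mono cover (measure_ne_top _ _)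
      _ ≤ _ := (measureReal_union_le _ _).trans (by gcongr; exact measureReal_union_le _ _)
  have h3 : 1 - η ≤ (bgSamples θ N L).real S := by linarith
  refine ge_iff_le.2 ((ENNReal.ofReal_le_ofReal h3).trans ?_)
  rw [ofReal_measureReal (measure_ne_top _ _)]

set_option maxHeartbeats 1000000 in
lemma aux_numeric {N L : ℕ} {θ δ : ℝ} (hN : 3 ≤ N) (hL2 : 2 ≤ L)
    (hNθ : 1 < (N : ℝ) * θ) (h0 : 0 < θ) (h12 : θ < 1 / 2) (hδ : 0 < δ)
    (hF : δ ^ 2 * ((N : ℝ) ^ 3 * Real.log L ^ 3 * Real.log (N * L) ^ 3 * θ) ≤ 1 / 1000000)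
    (hLL : (L : ℝ) ≥ 10 ^ 14 * δ⁻¹ ^ 2 * N * θ * Real.log ((N : ℝ) * θ / δ)) :
    bgSamples θ N L
            {ω | ∀ d : Fin N → ℝ, ∑ i, d i ^ 2 = 1 →
              Real.sqrt (∑ j, (tangProj N d (empGradF N L ω d) j -
                tangProj N d (popGradF θ N d) j) ^ 2) ≤ δ} ≥
          ENNReal.ofReal (1 - 1 / (L : ℝ)) := by
  have hN' : (3 : ℝ) ≤ N := by exact_mod_cast hN
  have hL' : (2 : ℝ) ≤ L := by exact_mod_cast hL2
  have hL0 : (0 : ℝ) < L := by linarith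
  have hm : 1 ≤ Real.log (N * L) := by
    rw [Real.le_log_iff_exp_le (by positivity)]
    have := Real.exp_one_lt_d9
    nlinarith
  have hml : 1 ≤ Real.log L * Real.log (N * L) := by
    have h2 : 0.69 ≤ Real.log L := by
      have := Real.log_two_gt_d9
      have := Real.log_le_log (by norm_num) hL'
      linarith
    have h3 : 1.5 ≤ Real.log (N * L) := by
      rw [Real.log_mul (by positivity) (by positivity)]
      have : 1 ≤ Real.log N := by
        rw [Real.le_log_iff_exp_le (by positivity)]
        have := Real.exp_one_lt_d9
        linarith
      linarith
    nlinarith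
  set ℓ := Real.log L with hℓ
  set m := Real.log (N * L)
  have hℓ0 : 0 < ℓ := Real.log_pos (by linarith)
  -- N δ small
  have hNδ : N * δ ≤ 1 / 1000 := by
    have h1 : 1 ≤ (ℓ * m) ^ 3 := one_le_pow₀ hml
    have h2 : (N * δ) ^ 2 ≤ (1 / 1000) ^ 2 := by
      calc (N * δ) ^ 2 = (N * δ) ^ 2 * 1 * 1 := by ring
        _ ≤ (N * δ) ^ 2 * (N * θ) * (ℓ * m) ^ 3 := by gcongr
        _ = δ ^ 2 * ((N : ℝ) ^ 3 * ℓ ^ 3 * m ^ 3 * θ) := by ring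
        _ ≤ _ := by linarith
    exact le_of_sq_le_sq h2 (by norm_num)
  have hδ1 : δ ≤ 1 / 3000 := by nlinarith
  -- Λ
  set Λ := Real.log ((N : ℝ) * θ / δ) with hΛ
  have hΛd : Real.log (1 / δ) ≤ Λ := by
    apply Real.log_le_log (by positivity)
    gcongr
  have hΛ1 : 1 ≤ Λ := by
    refine le_trans ?_ hΛd
    rw [Real.le_log_iff_exp_le (by positivity)]
    have := Real.exp_one_lt_d9
    rw [le_div_iff₀ hδ]
    nlinarith
  -- q
  obtain ⟨q, hq⟩ : ∃ q, q = L * δ ^ 2 / θ := ⟨_, rfl⟩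
  have hq0 : 0 < q := by rw [hq]; positivity
  have hqL : 10 ^ 14 * (N * Λ) ≤ q := by
    rw [hq, le_div_iff₀ h0]
    calc 10 ^ 14 * (N * Λ) * θ = (10 ^ 14 * δ⁻¹ ^ 2 * N * θ * Λ) * δ ^ 2 := by
          field_simp
      _ ≤ L * δ ^ 2 := by gcongr
  have hLbig : 10 ^ 14 ≤ L * δ ^ 2 := by
    have : q * θ = L * δ ^ 2 := by rw [hq]; field_simp
    rw [← this]
    calc (10:ℝ) ^ 14 = 10 ^ 14 * (1 * 1) := by ring
      _ ≤ 10 ^ 14 * ((N * θ) * Λ) := by gcongr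
      _ = 10 ^ 14 * (N * Λ) * θ := by ring
      _ ≤ q * θ := by gcongr
  have hLδ : 10 ^ 14 ≤ L * δ := by
    have : L * δ * δ ≤ L * δ * 1 := by gcongr; linarith only [hδ1]
    linarith only [this, hLbig]
  have hLbig' : (10 : ℝ) ^ 14 ≤ L := by
    have : L * δ ≤ L * 1 := by gcongr; linarith only [hδ1]
    linarith only [this, hLδ]
  have hℓ1 : 1 ≤ ℓ := by
    rw [hℓ, Real.le_log_iff_exp_le hL0]
    have := Real.exp_one_lt_d9
    linarith
  have hexpℓ : exp ℓ = L := Real.exp_log hL0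
  -- log bound
  have hlog : Real.log (2 * L) ≤ q / 6635520 + 6635520 + 2 * Λ := by
    have e : (2 * L : ℝ) = 2 * (q / 6635520) * 6635520 * θ * ((1 / δ) * (1 / δ)) := by
      rw [hq]; field_simp
    have l1 : Real.log (2 * L) = Real.log 2 + Real.log (q / 6635520) + Real.log 6635520
        + Real.log θ + (Real.log (1 / δ) + Real.log (1 / δ)) := by
      rw [e, Real.log_mul (by positivity) (by positivity),
        Real.log_mul (by positivity) (by positivity), Real.log_mul (by positivity) (by positivity),
        Real.log_mul (by positivity) (by positivity), Real.log_mul (by positivity) (by positivity)]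
    have l2 := Real.log_le_sub_one_of_pos (x := q / 6635520) (by positivity)
    have l3 := Real.log_le_sub_one_of_pos (x := 6635520) (by norm_num)
    have l4 := Real.log_le_sub_one_of_pos (x := 2) (by norm_num)
    have l5 : Real.log θ ≤ 0 := Real.log_nonpos h0.le (by linarith)
    linarith
  -- R
  set R := 4 * √(N * θ * ℓ) with hR
  have hR0 : 0 ≤ R := by positivity
  have hR2 : R ^ 2 = 16 * (N * θ * ℓ) := by
    rw [hR, mul_pow, Real.sq_sqrt (by positivity)]; norm_num
  have hR3 : δ * R ^ 3 ≤ θ := by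
    have hm3 : 1 ≤ m ^ 3 := one_le_pow₀ hm
    have : (δ * R ^ 3) ^ 2 ≤ θ ^ 2 := by
      calc (δ * R ^ 3) ^ 2 = δ ^ 2 * (R ^ 2) ^ 3 := by ring
        _ = 4096 * θ ^ 2 * (δ ^ 2 * (N ^ 3 * ℓ ^ 3 * 1 * θ)) := by rw [hR2]; ring
        _ ≤ 4096 * θ ^ 2 * (δ ^ 2 * (N ^ 3 * ℓ ^ 3 * m ^ 3 * θ)) := by gcongr
        _ ≤ 4096 * θ ^ 2 * (1 / 1000000) := by gcongr
        _ ≤ θ ^ 2 := by nlinarith [sq_nonneg θ]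
    exact le_of_sq_le_sq this h0.le
  -- K
  obtain ⟨K, hK⟩ : ∃ K : ℕ, K = ⌈72 * N / δ ^ 2⌉₊ := ⟨_, rfl⟩
  have hK1 : 72 * N / δ ^ 2 ≤ K := by rw [hK]; exact Nat.le_ceil _
  have hK2 : (K : ℝ) < 72 * N / δ ^ 2 + 1 := by rw [hK]; exact Nat.ceil_lt_add_one (by positivity)
  have hKpos' : (0 : ℝ) < K := lt_of_lt_of_le (by positivity) hK1
  have hKpos : 0 < K := by exact_mod_cast hKpos'
  have hKδ : 72 * N ≤ K * δ ^ 2 := by rwa [div_le_iff₀ (by positivity)] at hK1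
  have hK3 : ((2 * K + 1 : ℕ) : ℝ) ≤ (1 / δ) ^ 3 := by
    push_cast
    have : 72 * N / δ ^ 2 = 72 * (N * δ) * (1 / δ) ^ 3 := by field_simp
    have h3 : (1 / δ) ≥ 3000 := by rw [ge_iff_le, le_div_iff₀ hδ]; linarith
    have h4 : (3000 : ℝ) ^ 3 ≤ (1 / δ) ^ 3 := by gcongr
    have h5 : 72 * (N * δ) * (1 / δ) ^ 3 ≤ 72 * (1 / 1000) * (1 / δ) ^ 3 := by gcongr
    linarith
  have hKpow : ((2 * K + 1 : ℕ) : ℝ) ^ (2 * N) ≤ exp (6 * (N * Λ)) := by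
    calc ((2 * K + 1 : ℕ) : ℝ) ^ (2 * N) ≤ ((1 / δ) ^ 3) ^ (2 * N) := by gcongr
      _ = (exp (Real.log (1 / δ))) ^ (6 * N) := by
          rw [Real.exp_log (by positivity), ← pow_mul]; ring_nf
      _ = exp ((6 * N : ℕ) * Real.log (1 / δ)) := by rw [Real.exp_nat_mul]
      _ ≤ exp ((6 * N : ℕ) * Λ) := by gcongr
      _ = _ := by push_cast; ring_nf
  have hexp : ∀ c : ℝ, (N * θ) * (1 - (c + 1) * ℓ) ≤ -c * ℓ ∨ c < 0 := by
    intro c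
    rcases lt_or_ge c 0 with hc | hc
    · exact Or.inr hc
    · left
      have : (N * θ) * (1 - (c + 1) * ℓ) ≤ (N * θ) * (-c * ℓ) := by gcongr; linarith
      refine this.trans ?_
      have hcl := mul_nonneg hc hℓ0.le
      have := mul_le_mul_of_nonneg_right hNθ.le hcl
      linarith only [this]
  refine aux_prob_main h0.le (by linarith) (by omega) hKpos (R := R) (t := δ / 12)
    (lam := δ / (69120 * θ)) hR0 (by positivity) (by positivity) ?_ ?_ ?_
  · rw [div_mul_eq_mul_div, div_le_one (by positivity)]
    linarith
  · have b1 : 6 * ((N : ℝ) / K) * R ^ 3 ≤ δ / 12 := by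
      rw [mul_div_assoc', div_mul_eq_mul_div, div_le_iff₀ hKpos']
      have hNK : 72 * N * (δ * R ^ 3) ≤ K * δ ^ 2 * θ := by gcongr
      have h1 : K * δ ^ 2 * θ ≤ K * δ ^ 2 * 1 := by gcongr; linarith
      have h2 : δ * (72 * N * R ^ 3) ≤ δ * (K * δ) := by linarith
      have := le_of_mul_le_mul_left h2 hδ
      linarith
    have b2 : 128 * exp (N * θ - R ^ 2 / 8) ≤ δ / 12 := by
      have e1 : N * θ - R ^ 2 / 8 ≤ -ℓ := by
        rcases hexp 1 with h | h
        · rw [hR2]; linarith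
        · linarith
      calc 128 * exp (N * θ - R ^ 2 / 8) ≤ 128 * exp (-ℓ) := by gcongr
        _ = 128 / L := by rw [Real.exp_neg, hexpℓ]; rfl
        _ ≤ δ / 12 := by rw [div_le_iff₀ hL0]; linarith
    linarith
  · have t1 : L * exp (N * θ - R ^ 2 / 4) ≤ 1 / (2 * L) := by
      have e1 : N * θ - R ^ 2 / 4 ≤ -(3 * ℓ) := by
        rcases hexp 3 with h | h
        · rw [hR2]; linarith
        · linarith
      calc L * exp (N * θ - R ^ 2 / 4) ≤ L * exp (-(3 * ℓ)) := by gcongr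
        _ = L / L ^ 3 := by
            rw [Real.exp_neg, show (3 : ℝ) * ℓ = ((3 : ℕ) : ℝ) * ℓ by norm_num,
              Real.exp_nat_mul, hexpℓ]; rfl
        _ = 1 / (L * L) := by field_simp
        _ ≤ 1 / (2 * L) := by gcongr
    have t2 : ((2 * K + 1 : ℕ) : ℝ) ^ (2 * N) *
        exp (L * ((δ / (69120 * θ)) ^ 2 * (2880 * θ) - δ / (69120 * θ) * (δ / 12)))
        ≤ 1 / (2 * L) := by
      have e1 : L * ((δ / (69120 * θ)) ^ 2 * (2880 * θ) - δ / (69120 * θ) * (δ / 12))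
          = - (q / 1658880) := by
        rw [hq]; field_simp; norm_num
      rw [e1]
      calc _ ≤ exp (6 * (N * Λ)) * exp (- (q / 1658880)) := by gcongr
        _ = exp (6 * (N * Λ) - q / 1658880) := by rw [← Real.exp_add]; ring_nf
        _ ≤ exp (- Real.log (2 * L)) := by
            apply Real.exp_le_exp.2
            have hΛN : 1 * Λ ≤ N * Λ := by gcongr; linarith only [hN']
            linarith only [hΛN, hlog, hqL, hΛ1]
        _ = 1 / (2 * L) := by
            rw [Real.exp_neg, Real.exp_log (by positivity), one_div]
    calc _ ≤ 1 / (2 * (L : ℝ)) + 1 / (2 * L) := add_le_add t1 t2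
      _ = 1 / L := by field_simp; norm_num

/-- concentration of the Riemannian gradient: there are absolute
constants c₁, C₁ > 0 such that for θ ∈ (1/N, 1/2), any
δ ∈ (0, c₁/(N log L log(NL) θ^{1/3})^{3/2}) and any L ≥ C₁ δ⁻² N θ log(Nθ/δ),
with probability ≥ 1 − 1/L,
sup_{d ∈ S^{N−1}} ‖(I−ddᵀ)∇f(d) − (I−ddᵀ)𝔼[∇f(d)]‖ ≤ δ. -/
theorem stmt10 :
    ∃ c₁ > (0 : ℝ), ∃ C₁ > (0 : ℝ),
      ∀ (N L : ℕ) (θ δ : ℝ),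
        1 / (N : ℝ) < θ → θ < 1 / 2 →
        0 < δ →
        δ < c₁ / ((N : ℝ) * Real.log L * Real.log (N * L) * θ ^ ((1 : ℝ) / 3))
              ^ ((3 : ℝ) / 2) →
        (L : ℝ) ≥ C₁ * δ⁻¹ ^ 2 * N * θ * Real.log ((N : ℝ) * θ / δ) →
        bgSamples θ N L
            {ω | ∀ d : Fin N → ℝ, ∑ i, d i ^ 2 = 1 →
              Real.sqrt (∑ j, (tangProj N d (empGradF N L ω d) j -
                tangProj N d (popGradF θ N d) j) ^ 2) ≤ δ} ≥
          ENNReal.ofReal (1 - 1 / (L : ℝ)) := by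
  refine ⟨1 / 1000, by norm_num, 10 ^ 14, by norm_num, ?_⟩
  intro N L θ δ hNθ h12 hδ hδc hLL
  rcases Nat.eq_zero_or_pos N with hN0 | hN0
  · subst hN0
    have h0 : 0 < θ := by simpa using hNθ
    have := aux_prob h0.le (by linarith)
    have : IsProbabilityMeasure (bgPi θ 0) := by unfold bgPi; infer_instance
    have : IsProbabilityMeasure (bgSamples θ 0 L) := by unfold bgSamples; infer_instance
    have hu : {ω : Fin L → Fin 0 → ℝ | ∀ d : Fin 0 → ℝ, ∑ i, d i ^ 2 = 1 →
              Real.sqrt (∑ j, (tangProj 0 d (empGradF 0 L ω d) j -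
                tangProj 0 d (popGradF θ 0 d) j) ^ 2) ≤ δ} = Set.univ := by
      refine Set.eq_univ_of_forall fun ω d hd => ?_
      simp at hd
    rw [hu, measure_univ, ge_iff_le]
    apply ENNReal.ofReal_le_one.2
    have : (0 : ℝ) ≤ 1 / L := by positivity
    linarith
  have hN' : (0 : ℝ) < N := by exact_mod_cast hN0
  have h0 : 0 < θ := lt_trans (by positivity) hNθ
  have hNθ' : 1 < (N : ℝ) * θ := by
    rw [div_lt_iff₀ hN'] at hNθ; linarith
  have hN3 : 3 ≤ N := by
    have : (2 : ℝ) < N := by nlinarith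
    exact_mod_cast this
  have hL2 : 2 ≤ L := by
    by_contra h
    have hl : Real.log L = 0 := by
      have : L = 0 ∨ L = 1 := by omega
      rcases this with h | h <;> simp [h]
    rw [hl] at hδc
    rw [mul_zero, zero_mul, zero_mul, Real.zero_rpow (by norm_num), div_zero] at hδc
    linarith
  refine aux_numeric hN3 hL2 hNθ' h0 h12 hδ ?_ hLL
  have hL' : (2 : ℝ) ≤ L := by exact_mod_cast hL2
  have hN3' : (3 : ℝ) ≤ N := by exact_mod_cast hN3
  have hℓ0 : 0 < Real.log L := Real.log_pos (by linarith)
  have hm0 : 0 < Real.log (N * L) := Real.log_pos (by nlinarith)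
  set X := (N : ℝ) * Real.log L * Real.log (N * L) * θ ^ ((1 : ℝ) / 3) with hX
  have hθ3 : 0 < θ ^ ((1 : ℝ) / 3) := Real.rpow_pos_of_pos h0 _
  have hX0 : 0 < X := by positivity
  have hY0 : 0 < X ^ ((3 : ℝ) / 2) := Real.rpow_pos_of_pos hX0 _
  rw [lt_div_iff₀ hY0] at hδc
  have hY2 : (X ^ ((3 : ℝ) / 2)) ^ 2 = (N : ℝ) ^ 3 * Real.log L ^ 3 * Real.log (N * L) ^ 3 * θ := by
    rw [← Real.rpow_natCast, ← Real.rpow_mul hX0.le]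
    norm_num
    rw [hX, mul_pow, mul_pow, mul_pow]
    congr 1
    rw [← Real.rpow_natCast, ← Real.rpow_mul h0.le]
    norm_num
  rw [← hY2, ← mul_pow]
  calc (δ * X ^ ((3 : ℝ) / 2)) ^ 2 ≤ (1 / 1000) ^ 2 := by gcongr
    _ ≤ _ := by norm_num
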